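/- Assume either α ∈ (0,1), or α = 1 and GᵀΣ_ν⁻¹G is positive definite. Let C_∞ be the unique positive definite solution of C_∞⁻¹ = GᵀΣ_ν⁻¹G + (α²C_∞ + Σ_ω)⁻¹ and let m_∞ ∈ ℝ^{N_θ} be the unique solution of C_∞⁻¹ m_∞ = GᵀΣ_ν⁻¹y + (α²C_∞ + Σ_ω)⁻¹(α m_∞ + (1−α) r_0). Then for every m_0 ∈ ℝ^{N_θ} and every symmetric positive semidefinite C_0, the mean sequence {m_n} of the Kalman iteration converges to m_∞ exponentially fast: there exist K > 0 and r ∈ (0,1) such that ‖m_n − m_∞‖ ≤ K rⁿ for all n. -/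

import Mathlib

open Matrix

section KalmanHelpers

variable {N : ℕ}

lemma kal_symm {A : Matrix (Fin N) (Fin N) ℝ} (hA : Aᵀ = A) (u v : Fin N → ℝ) :
    u ⬝ᵥ A *ᵥ v = v ⬝ᵥ A *ᵥ u := by
  rw [dotProduct_mulVec, ← mulVec_transpose, hA, dotProduct_comm]

lemma kal_transpose {A : Matrix (Fin N) (Fin N) ℝ} (hA : A.PosSemidef) : Aᵀ = A := by
  have := hA.isHermitian.eq
  rwa [conjTranspose_eq_transpose_of_trivial] at this

lemma kal_nonneg {A : Matrix (Fin N) (Fin N) ℝ} (hA : A.PosSemidef) (v : Fin N → ℝ) :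
    0 ≤ v ⬝ᵥ A *ᵥ v := by
  have := hA.dotProduct_mulVec_nonneg v
  simpa using this

lemma kal_inv_mulVec {A : Matrix (Fin N) (Fin N) ℝ} (hA : A.PosDef) (v : Fin N → ℝ) :
    A⁻¹ *ᵥ (A *ᵥ v) = v := by
  rw [mulVec_mulVec, nonsing_inv_mul _ ((isUnit_iff_isUnit_det _).1 hA.isUnit), one_mulVec]

lemma kal_mulVec_inv {A : Matrix (Fin N) (Fin N) ℝ} (hA : A.PosDef) (v : Fin N → ℝ) :
    A *ᵥ (A⁻¹ *ᵥ v) = v := by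
  rw [mulVec_mulVec, mul_nonsing_inv _ ((isUnit_iff_isUnit_det _).1 hA.isUnit), one_mulVec]

lemma kal_inv_anti {A B : Matrix (Fin N) (Fin N) ℝ} (hA : A.PosDef) (hB : B.PosDef)
    (h : ∀ v, v ⬝ᵥ A *ᵥ v ≤ v ⬝ᵥ B *ᵥ v) (v : Fin N → ℝ) :
    v ⬝ᵥ B⁻¹ *ᵥ v ≤ v ⬝ᵥ A⁻¹ *ᵥ v := by
  set u := B⁻¹ *ᵥ v with hu
  have h1 := kal_nonneg hA.inv.posSemidef (v - A *ᵥ u)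
  have hBu : B *ᵥ u = v := kal_mulVec_inv hB v
  have h2 := h u
  rw [hBu] at h2
  have h3 := kal_symm (kal_transpose hA.inv.posSemidef) (A *ᵥ u) v
  rw [mulVec_sub, kal_inv_mulVec hA] at h1
  simp only [sub_dotProduct, dotProduct_sub] at h1
  rw [h3, kal_inv_mulVec hA] at h1
  have c1 := dotProduct_comm (A *ᵥ u) u
  have c2 := dotProduct_comm v u
  have h4 : (A *ᵥ u) ⬝ᵥ A⁻¹ *ᵥ v = v ⬝ᵥ u := by rw [h3, kal_inv_mulVec hA]
  linarith

lemma kal_upper (A : Matrix (Fin N) (Fin N) ℝ) :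
    ∃ c > (0 : ℝ), ∀ v, v ⬝ᵥ A *ᵥ v ≤ c * (v ⬝ᵥ v) := by
  refine ⟨‖toEuclideanCLM (n := Fin N) (𝕜 := ℝ) A‖ + 1, by positivity, fun v => ?_⟩
  have h1 : v ⬝ᵥ A *ᵥ v = inner ℝ (WithLp.toLp 2 v)
      (toEuclideanCLM (n := Fin N) (𝕜 := ℝ) A (WithLp.toLp 2 v)) := by
    simp [EuclideanSpace.inner_eq_star_dotProduct, dotProduct_comm]
  have h2 : v ⬝ᵥ v = ‖WithLp.toLp 2 v‖ ^ 2 := by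
    rw [← real_inner_self_eq_norm_sq, EuclideanSpace.inner_eq_star_dotProduct]
    simp
  rw [h1, h2]
  have h3 := real_inner_le_norm (WithLp.toLp 2 v)
      (toEuclideanCLM (n := Fin N) (𝕜 := ℝ) A (WithLp.toLp 2 v))
  have h4 := (toEuclideanCLM (n := Fin N) (𝕜 := ℝ) A).le_opNorm (WithLp.toLp 2 v)
  have h5 := norm_nonneg (WithLp.toLp 2 v : EuclideanSpace ℝ (Fin N))
  nlinarith

lemma kal_smul_one_posDef {c : ℝ} (hc : 0 < c) :
    (c • (1 : Matrix (Fin N) (Fin N) ℝ)).PosDef := PosDef.one.smul hc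

lemma kal_smul_one_inv {c : ℝ} (hc : 0 < c) :
    (c • (1 : Matrix (Fin N) (Fin N) ℝ))⁻¹ = c⁻¹ • 1 := by
  apply inv_eq_left_inv
  rw [smul_mul_smul_comm, inv_mul_cancel₀ hc.ne', one_smul, mul_one]

lemma kal_lower_inv {A : Matrix (Fin N) (Fin N) ℝ} (hA : A.PosDef) {c : ℝ} (hc : 0 < c)
    (h : ∀ v, v ⬝ᵥ A *ᵥ v ≤ c * (v ⬝ᵥ v)) (v : Fin N → ℝ) :
    c⁻¹ * (v ⬝ᵥ v) ≤ v ⬝ᵥ A⁻¹ *ᵥ v := by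
  have := kal_inv_anti hA (kal_smul_one_posDef (N := N) hc)
    (by intro v; simpa [smul_mulVec] using h v) v
  simpa [kal_smul_one_inv hc, smul_mulVec] using this

lemma kal_lower {A : Matrix (Fin N) (Fin N) ℝ} (hA : A.PosDef) :
    ∃ c > (0 : ℝ), ∀ v, c * (v ⬝ᵥ v) ≤ v ⬝ᵥ A *ᵥ v := by
  obtain ⟨c, hc, h⟩ := kal_upper A⁻¹
  refine ⟨c⁻¹, inv_pos.2 hc, fun v => ?_⟩
  have := kal_lower_inv hA.inv hc h v
  rwa [nonsing_inv_nonsing_inv _ ((isUnit_iff_isUnit_det _).1 hA.isUnit)] at this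

lemma kal_tri {Q : Matrix (Fin N) (Fin N) ℝ} (hQ : Q.PosSemidef) (u v : Fin N → ℝ) :
    √((u - v) ⬝ᵥ Q *ᵥ (u - v)) ≤ √(u ⬝ᵥ Q *ᵥ u) + √(v ⬝ᵥ Q *ᵥ v) := by
  obtain ⟨B, rfl⟩ : ∃ B : Matrix (Fin N) (Fin N) ℝ, Q = Bᴴ * B := by
    open scoped MatrixOrder in
    exact CStarAlgebra.nonneg_iff_eq_star_mul_self.1 hQ.nonneg
  have key : ∀ w : Fin N → ℝ, √(w ⬝ᵥ (Bᴴ * B) *ᵥ w) = ‖WithLp.toLp 2 (B *ᵥ w)‖ := by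
    intro w
    rw [conjTranspose_eq_transpose_of_trivial, ← mulVec_mulVec, dotProduct_mulVec,
      vecMul_transpose, EuclideanSpace.norm_eq]
    simp [dotProduct, pow_two]
  rw [key, key, key, mulVec_sub, WithLp.toLp_sub]
  exact norm_sub_le _ _

/-- one step of the homogeneous error recursion -/
lemma kal_step {P H : Matrix (Fin N) (Fin N) ℝ} (hP : P.PosDef) (hH : H.PosSemidef)
    {α : ℝ} {a b : Fin N → ℝ} (h : (H + P⁻¹) *ᵥ a = α • P⁻¹ *ᵥ b) :
    a ⬝ᵥ (H + P⁻¹) *ᵥ a ≤ α ^ 2 * (b ⬝ᵥ P⁻¹ *ᵥ b) := by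
  have h1 := kal_nonneg hP.inv.posSemidef (a - α • b)
  have h2 := kal_nonneg hH a
  have h3 := kal_symm (kal_transpose hP.inv.posSemidef) a b
  have h4 : a ⬝ᵥ (H + P⁻¹) *ᵥ a = α * (a ⬝ᵥ P⁻¹ *ᵥ b) := by
    rw [h, dotProduct_smul, smul_eq_mul]
  have h5 : a ⬝ᵥ (H + P⁻¹) *ᵥ a = a ⬝ᵥ H *ᵥ a + a ⬝ᵥ P⁻¹ *ᵥ a := by
    rw [add_mulVec, dotProduct_add]
  simp only [mulVec_sub, mulVec_smul, sub_dotProduct, dotProduct_sub, smul_dotProduct,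
    dotProduct_smul, smul_eq_mul] at h1
  rw [← h3] at h1
  nlinarith

lemma kal_Pdef {S C : Matrix (Fin N) (Fin N) ℝ} (hS : S.PosDef) (hC : C.PosSemidef) (α : ℝ) :
    (α ^ 2 • C + S).PosDef := PosDef.posSemidef_add (hC.smul (sq_nonneg α)) hS

/-- uniform upper bound on the covariances -/
lemma kal_C_bound {H S : Matrix (Fin N) (Fin N) ℝ} (hH : H.PosSemidef) (hS : S.PosDef)
    {α : ℝ} (hα : 0 < α) (hcase : α < 1 ∨ (α = 1 ∧ H.PosDef))
    (C : ℕ → Matrix (Fin N) (Fin N) ℝ) (hC : ∀ n, (C n).PosSemidef)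
    (hCrec : ∀ n, C (n + 1) = (H + (α ^ 2 • C n + S)⁻¹)⁻¹) :
    ∃ c > (0 : ℝ), ∀ n v, v ⬝ᵥ C n *ᵥ v ≤ c * (v ⬝ᵥ v) := by
  obtain ⟨c0, hc0, h0⟩ := kal_upper (C 0)
  have hvv : ∀ v : Fin N → ℝ, 0 ≤ v ⬝ᵥ v := fun v => by
    simpa using dotProduct_star_self_nonneg v
  rcases hcase with h1 | ⟨-, hHd⟩
  · obtain ⟨s, hs, hsb⟩ := kal_upper S
    have hq : 0 < 1 - α ^ 2 := by nlinarith
    refine ⟨c0 + s / (1 - α ^ 2), by positivity, fun n => ?_⟩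
    induction n with
    | zero =>
      intro v
      have := h0 v
      have h2 : 0 ≤ s / (1 - α ^ 2) * (v ⬝ᵥ v) := mul_nonneg (by positivity) (hvv v)
      linarith
    | succ n ih =>
      intro v
      have hP := kal_Pdef hS (hC n) α
      have hQ : (H + (α ^ 2 • C n + S)⁻¹).PosDef := PosDef.posSemidef_add hH hP.inv
      have h3 := kal_inv_anti hP.inv hQ (fun w => by
        rw [add_mulVec, dotProduct_add]
        linarith [kal_nonneg hH w]) v
      rw [nonsing_inv_nonsing_inv _ ((isUnit_iff_isUnit_det _).1 hP.isUnit), ← hCrec,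
        add_mulVec, smul_mulVec, dotProduct_add, dotProduct_smul, smul_eq_mul] at h3
      have h4 := ih v
      have h5 := hsb v
      have h6 : α ^ 2 * (v ⬝ᵥ C n *ᵥ v) ≤ α ^ 2 * ((c0 + s / (1 - α ^ 2)) * (v ⬝ᵥ v)) :=
        mul_le_mul_of_nonneg_left h4 (sq_nonneg α)
      have h7 : s = (s / (1 - α ^ 2)) * (1 - α ^ 2) := by field_simp
      have h8 : 0 ≤ (1 - α ^ 2) * c0 * (v ⬝ᵥ v) := mul_nonneg (by positivity) (hvv v)
      have h9 : s * (v ⬝ᵥ v) = (s / (1 - α ^ 2)) * (1 - α ^ 2) * (v ⬝ᵥ v) := by rw [← h7]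
      nlinarith
  · obtain ⟨k, hk, hkb⟩ := kal_upper H⁻¹
    refine ⟨c0 + k, by positivity, fun n v => ?_⟩
    have e1 : 0 ≤ c0 * (v ⬝ᵥ v) := mul_nonneg hc0.le (hvv v)
    have e2 : 0 ≤ k * (v ⬝ᵥ v) := mul_nonneg hk.le (hvv v)
    cases n with
    | zero => linarith [h0 v]
    | succ n =>
      have hP := kal_Pdef hS (hC n) α
      have hQ : (H + (α ^ 2 • C n + S)⁻¹).PosDef := PosDef.posSemidef_add hH hP.inv
      have h3 := kal_inv_anti hHd hQ (fun w => by
        rw [add_mulVec, dotProduct_add]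
        linarith [kal_nonneg hP.inv.posSemidef w]) v
      rw [← hCrec] at h3
      linarith [hkb v]

lemma kal_core {H S : Matrix (Fin N) (Fin N) ℝ} (hH : H.PosSemidef) (hS : S.PosDef)
    {α : ℝ} (hα : 0 < α) (hcase : α < 1 ∨ (α = 1 ∧ H.PosDef))
    (Cinf : Matrix (Fin N) (Fin N) ℝ) (hCinf : Cinf.PosDef)
    (hfix : Cinf⁻¹ = H + (α ^ 2 • Cinf + S)⁻¹)
    (b r₀ minf : Fin N → ℝ)
    (hminf : Cinf⁻¹ *ᵥ minf = b + (α ^ 2 • Cinf + S)⁻¹ *ᵥ (α • minf + (1 - α) • r₀))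
    (C : ℕ → Matrix (Fin N) (Fin N) ℝ) (hC0 : (C 0).PosSemidef)
    (hCrec : ∀ n, C (n + 1) = (H + (α ^ 2 • C n + S)⁻¹)⁻¹)
    (m : ℕ → Fin N → ℝ)
    (hmrec : ∀ n, (C (n + 1))⁻¹ *ᵥ m (n + 1) =
      b + (α ^ 2 • C n + S)⁻¹ *ᵥ (α • m n + (1 - α) • r₀)) :
    ∃ K > (0 : ℝ), ∃ r ∈ Set.Ioo (0 : ℝ) 1, ∀ n,
      √((m n - minf) ⬝ᵥ (m n - minf)) ≤ K * r ^ n := by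
  have hvv : ∀ v : Fin N → ℝ, 0 ≤ v ⬝ᵥ v := fun v => by
    simpa using dotProduct_star_self_nonneg v
  have hC : ∀ n, (C n).PosSemidef := by
    intro n
    induction n with
    | zero => exact hC0
    | succ n ih =>
      rw [hCrec]
      exact (PosDef.posSemidef_add hH (kal_Pdef hS ih α).inv).inv.posSemidef
  obtain ⟨c, hc, hcb⟩ := kal_C_bound hH hS hα hcase C hC hCrec
  obtain ⟨s, hs, hsb⟩ := kal_lower hS
  obtain ⟨s', hs', hsb'⟩ := kal_upper S
  set P : ℕ → Matrix (Fin N) (Fin N) ℝ := fun n => α ^ 2 • C n + S with hPdef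
  have hP : ∀ n, (P n).PosDef := fun n => kal_Pdef hS (hC n) α
  have hQ : ∀ n, (H + (P n)⁻¹).PosDef := fun n => PosDef.posSemidef_add hH (hP n).inv
  have hCrec' : ∀ n, C (n + 1) = (H + (P n)⁻¹)⁻¹ := hCrec
  have hCinv : ∀ n, (C (n + 1))⁻¹ = H + (P n)⁻¹ := fun n => by
    rw [hCrec', nonsing_inv_nonsing_inv _ ((isUnit_iff_isUnit_det _).1 (hQ n).isUnit)]
  have hCpd : ∀ n, (C (n + 1)).PosDef := fun n => by rw [hCrec']; exact (hQ n).inv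
  set Pi : Matrix (Fin N) (Fin N) ℝ := α ^ 2 • Cinf + S with hPi
  have hPip : Pi.PosDef := kal_Pdef hS hCinf.posSemidef α
  have hPv : ∀ n v, v ⬝ᵥ P n *ᵥ v = α ^ 2 * (v ⬝ᵥ C n *ᵥ v) + v ⬝ᵥ S *ᵥ v := fun n v => by
    simp only [hPdef, add_mulVec, smul_mulVec, dotProduct_add, dotProduct_smul, smul_eq_mul]
  -- contraction factor
  set ε : ℝ := s / c with hε
  have hεp : 0 < ε := by positivity
  set q : ℝ := α ^ 2 / (α ^ 2 + ε) with hq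
  have hq0 : 0 < q := by positivity
  have hq1 : q < 1 := by rw [hq, div_lt_one (by positivity)]; linarith
  -- one-step contraction
  have hstep : ∀ n (x : Fin N → ℝ), (α • C (n + 1) *ᵥ ((P n)⁻¹ *ᵥ x)) ⬝ᵥ
      (P (n + 1))⁻¹ *ᵥ (α • C (n + 1) *ᵥ ((P n)⁻¹ *ᵥ x)) ≤ q * (x ⬝ᵥ (P n)⁻¹ *ᵥ x) := by
    intro n x
    set a := α • C (n + 1) *ᵥ ((P n)⁻¹ *ᵥ x) with ha
    have h1 : (H + (P n)⁻¹) *ᵥ a = α • (P n)⁻¹ *ᵥ x := by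
      rw [ha, ← hCinv, mulVec_smul, kal_inv_mulVec (hCpd n)]
    have h2 := kal_step (hP n) hH h1
    have hpos : 0 < α ^ 2 + ε := by positivity
    have h3 := kal_inv_anti ((hCpd n).smul hpos) (hP (n + 1)) (fun w => by
      rw [hPv, smul_mulVec, dotProduct_smul, smul_eq_mul]
      have e1 := hcb (n + 1) w
      have e2 := hsb w
      have e3 : ε * (w ⬝ᵥ C (n + 1) *ᵥ w) ≤ ε * (c * (w ⬝ᵥ w)) :=
        mul_le_mul_of_nonneg_left e1 hεp.le
      have e4 : ε * (c * (w ⬝ᵥ w)) = s * (w ⬝ᵥ w) := by rw [hε]; field_simp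
      linarith) a
    have h4 : ((α ^ 2 + ε) • C (n + 1))⁻¹ = (α ^ 2 + ε)⁻¹ • (H + (P n)⁻¹) := by
      rw [← hCinv]
      apply inv_eq_left_inv
      rw [smul_mul_smul_comm, inv_mul_cancel₀ hpos.ne', one_smul,
        nonsing_inv_mul _ ((isUnit_iff_isUnit_det _).1 (hCpd n).isUnit)]
    rw [h4, smul_mulVec, dotProduct_smul, smul_eq_mul] at h3
    calc _ ≤ _ := h3
      _ ≤ (α ^ 2 + ε)⁻¹ * (α ^ 2 * (x ⬝ᵥ (P n)⁻¹ *ᵥ x)) :=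
        mul_le_mul_of_nonneg_left h2 (by positivity)
      _ = _ := by rw [hq]; ring
  set W : ℕ → (Fin N → ℝ) → ℝ := fun n x => √(x ⬝ᵥ (P n)⁻¹ *ᵥ x) with hW
  have hW0 : ∀ n x, 0 ≤ W n x := fun n x => Real.sqrt_nonneg _
  set ρ := √q with hρ
  have hρ0 : 0 < ρ := Real.sqrt_pos.2 hq0
  have hρ1 : ρ < 1 := by rw [hρ, Real.sqrt_lt' one_pos]; simpa using hq1
  have hstepW : ∀ n x, W (n + 1) (α • C (n + 1) *ᵥ ((P n)⁻¹ *ᵥ x)) ≤ ρ * W n x := by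
    intro n x
    simp only [hW, hρ]
    rw [← Real.sqrt_mul hq0.le]
    exact Real.sqrt_le_sqrt (hstep n x)
  -- the dual step for the limit
  have hdual : ∀ x : Fin N → ℝ, √((α • Pi⁻¹ *ᵥ (Cinf *ᵥ x)) ⬝ᵥ Pi *ᵥ (α • Pi⁻¹ *ᵥ (Cinf *ᵥ x)))
      ≤ √(x ⬝ᵥ Pi *ᵥ x) := by
    intro x
    apply Real.sqrt_le_sqrt
    rw [mulVec_smul, kal_mulVec_inv hPip, smul_dotProduct, dotProduct_smul, smul_eq_mul,
      smul_eq_mul, dotProduct_comm]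
    have h1 : (Cinf *ᵥ x) ⬝ᵥ Pi⁻¹ *ᵥ (Cinf *ᵥ x) ≤ (Cinf *ᵥ x) ⬝ᵥ Cinf⁻¹ *ᵥ (Cinf *ᵥ x) := by
      rw [hfix, add_mulVec, dotProduct_add]
      linarith [kal_nonneg hH (Cinf *ᵥ x)]
    rw [kal_inv_mulVec hCinf, dotProduct_comm (Cinf *ᵥ x) x] at h1
    have h2 : x ⬝ᵥ Pi *ᵥ x = α ^ 2 * (x ⬝ᵥ Cinf *ᵥ x) + x ⬝ᵥ S *ᵥ x := by
      simp only [hPi, add_mulVec, smul_mulVec, dotProduct_add, dotProduct_smul, smul_eq_mul]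
    have h3 := kal_nonneg hS.posSemidef x
    have h4 := mul_le_mul_of_nonneg_left h1 (sq_nonneg α)
    rw [h2]
    nlinarith
  -- resolvent-type identity
  have hres : ∀ n (x : Fin N → ℝ), α ^ 2 • (P n)⁻¹ *ᵥ ((C n - Cinf) *ᵥ (Pi⁻¹ *ᵥ x))
      = Pi⁻¹ *ᵥ x - (P n)⁻¹ *ᵥ x := by
    intro n x
    have h1 : α ^ 2 • (C n - Cinf) = P n - Pi := by
      simp only [hPdef, hPi, smul_sub]; abel
    rw [← mulVec_smul, ← smul_mulVec, h1, sub_mulVec, kal_mulVec_inv hPip, mulVec_sub,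
      kal_inv_mulVec (hP n)]
  -- covariance difference recursion
  have hD : ∀ n (x : Fin N → ℝ), (C (n + 1) - Cinf) *ᵥ x =
      α • C (n + 1) *ᵥ ((P n)⁻¹ *ᵥ ((C n - Cinf) *ᵥ (α • Pi⁻¹ *ᵥ (Cinf *ᵥ x)))) := by
    intro n x
    have h1 := hres n (Cinf *ᵥ x)
    have h2 : C (n + 1) *ᵥ (α ^ 2 • (P n)⁻¹ *ᵥ ((C n - Cinf) *ᵥ (Pi⁻¹ *ᵥ (Cinf *ᵥ x))))
        = (C (n + 1) - Cinf) *ᵥ x := by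
      rw [h1]
      have h3 : Pi⁻¹ *ᵥ (Cinf *ᵥ x) - (P n)⁻¹ *ᵥ (Cinf *ᵥ x)
          = Cinf⁻¹ *ᵥ (Cinf *ᵥ x) - (C (n + 1))⁻¹ *ᵥ (Cinf *ᵥ x) := by
        rw [hfix, hCinv, add_mulVec, add_mulVec]; abel
      rw [h3, kal_inv_mulVec hCinf, mulVec_sub, kal_mulVec_inv (hCpd n), sub_mulVec]
    rw [← h2]
    simp only [mulVec_smul, smul_smul, pow_two]
  -- decay of the covariance difference
  obtain ⟨L, hL, hD0⟩ : ∃ L > (0 : ℝ), ∀ x, W 0 ((C 0 - Cinf) *ᵥ x) ≤ L * √(x ⬝ᵥ Pi *ᵥ x) := by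
    obtain ⟨k, hk, hkb⟩ := kal_upper ((C 0 - Cinf)ᵀ * (P 0)⁻¹ * (C 0 - Cinf))
    obtain ⟨l, hl, hlb⟩ := kal_lower hPip
    refine ⟨√(k / l), Real.sqrt_pos.2 (by positivity), fun x => ?_⟩
    rw [← Real.sqrt_mul (by positivity)]
    apply Real.sqrt_le_sqrt
    have h1 := hkb x
    rw [← mulVec_mulVec, ← mulVec_mulVec, dotProduct_mulVec, vecMul_transpose] at h1
    refine h1.trans ?_
    have h2 := mul_le_mul_of_nonneg_left (hlb x) (by positivity : 0 ≤ k / l)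
    refine le_trans (le_of_eq ?_) h2
    field_simp
  have hDn : ∀ n x, W n ((C n - Cinf) *ᵥ x) ≤ L * ρ ^ n * √(x ⬝ᵥ Pi *ᵥ x) := by
    intro n
    induction n with
    | zero => intro x; simpa using hD0 x
    | succ n ih =>
      intro x
      rw [hD n x]
      refine (hstepW n _).trans ?_
      have h1 := (ih (α • Pi⁻¹ *ᵥ (Cinf *ᵥ x))).trans
        (mul_le_mul_of_nonneg_left (hdual x) (by positivity))
      have h2 := mul_le_mul_of_nonneg_left h1 hρ0.le
      refine h2.trans (le_of_eq ?_)
      ring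
  -- error recursion
  set g : Fin N → ℝ := ((1 - α) * α) • Pi⁻¹ *ᵥ (r₀ - minf) with hg
  have he : ∀ n, m (n + 1) - minf =
      α • C (n + 1) *ᵥ ((P n)⁻¹ *ᵥ ((m n - minf) - (C n - Cinf) *ᵥ g)) := by
    intro n
    have hinj : ∀ u v : Fin N → ℝ, (C (n + 1))⁻¹ *ᵥ u = (C (n + 1))⁻¹ *ᵥ v → u = v := by
      intro u v huv
      rw [← kal_mulVec_inv (hCpd n) u, huv, kal_mulVec_inv (hCpd n)]
    apply hinj
    rw [mulVec_smul, kal_inv_mulVec (hCpd n)]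
    have h1 := hres n (r₀ - minf)
    have h2 : α • (P n)⁻¹ *ᵥ ((C n - Cinf) *ᵥ g)
        = (1 - α) • (Pi⁻¹ *ᵥ (r₀ - minf) - (P n)⁻¹ *ᵥ (r₀ - minf)) := by
      rw [← h1, hg]
      simp only [mulVec_smul, smul_smul]
      congr 1; ring
    have h3 : (C (n + 1))⁻¹ *ᵥ m (n + 1) = b + (P n)⁻¹ *ᵥ (α • m n + (1 - α) • r₀) := hmrec n
    have h4 : Cinf⁻¹ *ᵥ minf = b + Pi⁻¹ *ᵥ (α • minf + (1 - α) • r₀) := hminf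
    have h5 : (C (n + 1))⁻¹ *ᵥ minf = Cinf⁻¹ *ᵥ minf - Pi⁻¹ *ᵥ minf + (P n)⁻¹ *ᵥ minf := by
      rw [hfix, hCinv, add_mulVec, add_mulVec]; abel
    rw [mulVec_sub, h3, h5, h4, mulVec_sub (P n)⁻¹, smul_sub, h2]
    simp only [mulVec_sub, mulVec_add, mulVec_smul]
    module
  set T : ℝ := L * √(g ⬝ᵥ Pi *ᵥ g) with hT
  have hT0 : 0 ≤ T := by positivity
  obtain ⟨r, hr, hr1⟩ := exists_between hρ1
  have hr0 : 0 < r := hρ0.trans hr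
  set M : ℝ := W 0 (m 0 - minf) + ρ * T / (r - ρ) + 1 with hM
  have hrρ : 0 < r - ρ := sub_pos.2 hr
  have hMp : 0 < M := by have := hW0 0 (m 0 - minf); positivity
  have hMT : ρ * T ≤ M * (r - ρ) := by
    rw [← div_le_iff₀ hrρ]; linarith [hW0 0 (m 0 - minf)]
  have hE : ∀ n, W n (m n - minf) ≤ M * r ^ n := by
    intro n
    induction n with
    | zero =>
      have : 0 ≤ ρ * T / (r - ρ) := by positivity
      simp only [pow_zero, mul_one]; linarith
    | succ n ih =>
      rw [he n]
      refine (hstepW n _).trans ?_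
      have h1 := kal_tri (hP n).inv.posSemidef (m n - minf) ((C n - Cinf) *ᵥ g)
      have h2 := hDn n g
      have h3 : ρ ^ n ≤ r ^ n := pow_le_pow_left₀ hρ0.le hr.le n
      have h4 : L * ρ ^ n * √(g ⬝ᵥ Pi *ᵥ g) ≤ T * r ^ n := by
        calc _ = T * ρ ^ n := by rw [hT]; ring
          _ ≤ _ := mul_le_mul_of_nonneg_left h3 hT0
      have h5 : W n ((m n - minf) - (C n - Cinf) *ᵥ g) ≤ M * r ^ n + T * r ^ n :=
        h1.trans (add_le_add ih (h2.trans h4))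
      have h6 := mul_le_mul_of_nonneg_left h5 hρ0.le
      have h7 := mul_le_mul_of_nonneg_right hMT (pow_pos hr0 n).le
      refine h6.trans ?_
      rw [pow_succ]
      nlinarith
  set p : ℝ := α ^ 2 * c + s' with hp
  have hpp : 0 < p := by positivity
  refine ⟨√p * M, by positivity, r, ⟨hr0, hr1⟩, fun n => ?_⟩
  have h1 := kal_lower_inv (hP n) hpp (fun v => by
    rw [hPv]
    have e1 := mul_le_mul_of_nonneg_left (hcb n v) (sq_nonneg α)
    have e2 := hsb' v
    rw [hp]; linarith) (m n - minf)
  have h2 : (m n - minf) ⬝ᵥ (m n - minf) ≤ p * ((m n - minf) ⬝ᵥ (P n)⁻¹ *ᵥ (m n - minf)) := by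
    rwa [inv_mul_le_iff₀ hpp] at h1
  calc _ ≤ _ := Real.sqrt_le_sqrt h2
    _ = √p * W n (m n - minf) := Real.sqrt_mul hpp.le _
    _ ≤ √p * (M * r ^ n) := mul_le_mul_of_nonneg_left (hE n) (Real.sqrt_nonneg _)
    _ = _ := by ring

end KalmanHelpers


/-- Assume either `α ∈ (0,1)`, or `α = 1` and `Gᵀ Sν⁻¹ G` is positive
definite. Let `Cinf` be the (unique) positive definite solution of
`Cinf⁻¹ = Gᵀ Sν⁻¹ G + (α² Cinf + Sω)⁻¹` and let `minf` be the (unique) solution of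
`Cinf⁻¹ minf = Gᵀ Sν⁻¹ y + (α² Cinf + Sω)⁻¹ (α minf + (1−α) r₀)`. Then for every
`m 0` and every symmetric positive semidefinite `C 0`, the mean sequence `m n` of the
Kalman iteration converges to `minf` exponentially fast: there exist `K > 0` and
`r ∈ (0,1)` with `‖m n − minf‖ ≤ K rⁿ` for all `n` (Euclidean norm). -/
theorem kalman_mean_exponential_convergence
    {Nθ Ny : ℕ} (hNθ : 0 < Nθ) (hNy : 0 < Ny)
    (G : Matrix (Fin Ny) (Fin Nθ) ℝ)
    (y : EuclideanSpace ℝ (Fin Ny)) (r₀ : EuclideanSpace ℝ (Fin Nθ))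
    (Sν : Matrix (Fin Ny) (Fin Ny) ℝ) (hSν : Sν.PosDef)
    (Sω : Matrix (Fin Nθ) (Fin Nθ) ℝ) (hSω : Sω.PosDef)
    (α : ℝ) (hα : 0 < α)
    (hcase : α < 1 ∨ (α = 1 ∧ (Gᵀ * Sν⁻¹ * G).PosDef))
    (Cinf : Matrix (Fin Nθ) (Fin Nθ) ℝ) (hCinf : Cinf.PosDef)
    (hfix : Cinf⁻¹ = Gᵀ * Sν⁻¹ * G + (α ^ 2 • Cinf + Sω)⁻¹)
    (minf : EuclideanSpace ℝ (Fin Nθ))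
    (hminf : Cinf⁻¹ *ᵥ minf =
      (Gᵀ * Sν⁻¹) *ᵥ y + (α ^ 2 • Cinf + Sω)⁻¹ *ᵥ (α • minf + (1 - α) • r₀))
    (C : ℕ → Matrix (Fin Nθ) (Fin Nθ) ℝ) (hC0 : (C 0).PosSemidef)
    (hCrec : ∀ n, C (n + 1) = (Gᵀ * Sν⁻¹ * G + (α ^ 2 • C n + Sω)⁻¹)⁻¹)
    (m : ℕ → EuclideanSpace ℝ (Fin Nθ))
    (hmrec : ∀ n, (C (n + 1))⁻¹ *ᵥ m (n + 1) =
      (Gᵀ * Sν⁻¹) *ᵥ y + (α ^ 2 • C n + Sω)⁻¹ *ᵥ (α • m n + (1 - α) • r₀)) :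
    ∃ K > (0 : ℝ), ∃ r ∈ Set.Ioo (0 : ℝ) 1, ∀ n, ‖m n - minf‖ ≤ K * r ^ n := by
  have hH : (Gᵀ * Sν⁻¹ * G).PosSemidef := by
    have := hSν.inv.posSemidef.conjTranspose_mul_mul_same G
    rwa [conjTranspose_eq_transpose_of_trivial] at this
  obtain ⟨K, hK, r, hr, h⟩ := kal_core hH hSω hα hcase Cinf hCinf hfix
    ((Gᵀ * Sν⁻¹) *ᵥ y) r₀ minf hminf C hC0 hCrec (fun n => m n) hmrec
  refine ⟨K, hK, r, hr, fun n => ?_⟩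
  refine le_trans (le_of_eq ?_) (h n)
  rw [EuclideanSpace.norm_eq]
  simp [dotProduct, pow_two]
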